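/- Let X and Y be Hausdorff topological spaces with X compact and Y connected, and let f : X → Y be a local homeomorphism. Then f is a covering map and every fiber f⁻¹(y) is finite. -/

import Mathlib

/-- A local homeomorphism from a compact Hausdorff space to a connected Hausdorff
space is a finite-sheeted covering map. -/
theorem localHomeomorph_compact_to_connected_isCoveringMap
    {X Y : Type*} [TopologicalSpace X] [TopologicalSpace Y]
    [T2Space X] [T2Space Y] [CompactSpace X] [ConnectedSpace Y]
    {f : X → Y} (hf : IsLocalHomeomorph f) :
    IsCoveringMap f ∧ ∀ y : Y, (f ⁻¹' {y}).Finite := by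
  have hc : IsCoveringMap f := isLocalHomeomorph_iff_isCoveringMap.mp hf
  refine ⟨hc, fun y => ?_⟩
  exact (isClosed_singleton.preimage hf.continuous).isCompact.finite
    ⟨(hc y).discreteTopology_fiber⟩
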